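/- ReLU network approximating the product of r numbers (Lemma A.3). For any positive integers m and r there exists a ReLU network Mult_m^r ∈ F((m+5)·⌈log₂ r⌉, (r, 6r, 6r, …, 6r, 1)) — i.e., input dimension r, (m+5)·⌈log₂ r⌉ hidden layers each of width 6r, output dimension 1, all parameters bounded in absolute value by 1 — such that Mult_m^r(x) ∈ [0,1] for all x ∈ [0,1]^r, |Mult_m^r(x) − ∏_{i=1}^r x_i| ≤ r²·2^{−m} for all x = (x₁,…,x_r) ∈ [0,1]^r, and Mult_m^r(x) = 0 whenever at least one component of x is zero. -/

import Mathlib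

open MeasureTheory ProbabilityTheory

noncomputable section

/-! ## ReLU networks -/

/-- The ReLU activation function. -/
def relu (x : ℝ) : ℝ := max x 0

/-- Componentwise shifted ReLU activation `σ_v`. -/
def shiftAct {k : ℕ} (v y : Fin k → ℝ) : Fin k → ℝ := fun j => relu (y j - v j)

/-- Value after applying `W_k σ_{v_k} ⋯ σ_{v_1} W_0` to the input `x`. -/
def netLayers (p : ℕ → ℕ) (W : ∀ i, Matrix (Fin (p (i + 1))) (Fin (p i)) ℝ)
    (v : ∀ i, Fin (p i) → ℝ) (x : Fin (p 0) → ℝ) : (k : ℕ) → Fin (p (k + 1)) → ℝ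
  | 0 => (W 0).mulVec x
  | k + 1 => (W (k + 1)).mulVec (shiftAct (v (k + 1)) (netLayers p W v x k))

/-- The function `x ↦ W_L σ_{v_L} W_{L-1} ⋯ W_1 σ_{v_1} W_0 x` computed by a
network with `L` hidden layers and width vector `p 0, …, p (L+1)`. -/
def networkFun (L : ℕ) (p : ℕ → ℕ) (W : ∀ i, Matrix (Fin (p (i + 1))) (Fin (p i)) ℝ)
    (v : ∀ i, Fin (p i) → ℝ) : (Fin (p 0) → ℝ) → Fin (p (L + 1)) → ℝ :=
  fun x => netLayers p W v x L

/-- Number of nonzero entries of a matrix. -/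
def matSupp {a b : ℕ} (W : Matrix (Fin a) (Fin b) ℝ) : ℕ :=
  {ij : Fin a × Fin b | W ij.1 ij.2 ≠ 0}.ncard

/-- Number of nonzero entries of a vector. -/
def vecSupp {a : ℕ} (v : Fin a → ℝ) : ℕ := {j : Fin a | v j ≠ 0}.ncard

/-- Total number of nonzero network parameters. -/
def totalSparsity (L : ℕ) (p : ℕ → ℕ) (W : ∀ i, Matrix (Fin (p (i + 1))) (Fin (p i)) ℝ)
    (v : ∀ i, Fin (p i) → ℝ) : ℕ :=
  (∑ i ∈ Finset.range (L + 1), matSupp (W i)) + ∑ i ∈ Finset.Icc 1 L, vecSupp (v i)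

/-- `F(L,p)`: network functions with all parameters bounded in absolute value by one. -/
def NetClass (L : ℕ) (p : ℕ → ℕ) : Set ((Fin (p 0) → ℝ) → Fin (p (L + 1)) → ℝ) :=
  {f | ∃ (W : ∀ i, Matrix (Fin (p (i + 1))) (Fin (p i)) ℝ) (v : ∀ i, Fin (p i) → ℝ),
    (∀ i j k, |W i j k| ≤ 1) ∧ (∀ i j, |v i j| ≤ 1) ∧ f = networkFun L p W v}

/-- `F(L,p,s)`: networks with at most `s` nonzero parameters. -/
def SparseNetClass (L : ℕ) (p : ℕ → ℕ) (s : ℕ) :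
    Set ((Fin (p 0) → ℝ) → Fin (p (L + 1)) → ℝ) :=
  {f | ∃ (W : ∀ i, Matrix (Fin (p (i + 1))) (Fin (p i)) ℝ) (v : ∀ i, Fin (p i) → ℝ),
    (∀ i j k, |W i j k| ≤ 1) ∧ (∀ i j, |v i j| ≤ 1) ∧
    totalSparsity L p W v ≤ s ∧ f = networkFun L p W v}

/-- The unit hypercube `[0,1]^r`. -/
def unitCube (r : ℕ) : Set (Fin r → ℝ) := {x | ∀ i, x i ∈ Set.Icc (0 : ℝ) 1}

/-- `F(L,p,s,F)`: sparse networks uniformly bounded by `F` on the unit cube. -/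
def SparseNetClassB (L : ℕ) (p : ℕ → ℕ) (s : ℕ) (F : ℝ) :
    Set ((Fin (p 0) → ℝ) → Fin (p (L + 1)) → ℝ) :=
  {f | f ∈ SparseNetClass L p s ∧ ∀ x ∈ unitCube (p 0), ∀ j, |f x j| ≤ F}

/-- Scalar-valued version of `F(L,p)` for input dimension `din`; membership
forces `p 0 = din`, and is meaningful for `p (L+1) = 1`. -/
def ScalarNetClassD (din L : ℕ) (p : ℕ → ℕ) : Set ((Fin din → ℝ) → ℝ) :=
  {f | ∃ h0 : p 0 = din, ∃ g ∈ NetClass L p,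
    ∀ (x : Fin din → ℝ) (j : Fin (p (L + 1))), f x = g (fun k => x (Fin.cast h0 k)) j}

/-- Scalar-valued version of `F(L,p,s)`. -/
def ScalarSparseNetClassD (din L : ℕ) (p : ℕ → ℕ) (s : ℕ) : Set ((Fin din → ℝ) → ℝ) :=
  {f | ∃ h0 : p 0 = din, ∃ g ∈ SparseNetClass L p s,
    ∀ (x : Fin din → ℝ) (j : Fin (p (L + 1))), f x = g (fun k => x (Fin.cast h0 k)) j}

/-- Scalar-valued version of `F(L,p,s,F)`. -/
def ScalarSparseNetClassBD (din L : ℕ) (p : ℕ → ℕ) (s : ℕ) (F : ℝ) :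
    Set ((Fin din → ℝ) → ℝ) :=
  {f | ∃ h0 : p 0 = din, ∃ g ∈ SparseNetClassB L p s F,
    ∀ (x : Fin din → ℝ) (j : Fin (p (L + 1))), f x = g (fun k => x (Fin.cast h0 k)) j}

/-! ## Hölder balls -/

/-- The largest integer strictly smaller than `β` (for `β > 0`). -/
def strictFloor (β : ℝ) : ℕ := (⌈β⌉ - 1).toNat

/-- Partial derivative in direction `i`. -/
def partialDeriv {r : ℕ} (i : Fin r) (f : (Fin r → ℝ) → ℝ) : (Fin r → ℝ) → ℝ :=
  fun x => fderiv ℝ f x (Pi.single i 1)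

def multiPartialList {r : ℕ} : List (Fin r) → ((Fin r → ℝ) → ℝ) → (Fin r → ℝ) → ℝ
  | [], f => f
  | i :: l, f => partialDeriv i (multiPartialList l f)

/-- Mixed partial derivative `∂^α f` for a multi-index `α`. -/
def multiPartial {r : ℕ} (α : Fin r → ℕ) (f : (Fin r → ℝ) → ℝ) : (Fin r → ℝ) → ℝ :=
  multiPartialList ((List.finRange r).flatMap fun i => List.replicate (α i) i) f

/-- Multi-indices `α` with `|α| < β`. -/
def multiIndicesLt (r : ℕ) (β : ℝ) : Finset (Fin r → ℕ) :=
  (Fintype.piFinset fun _ : Fin r => Finset.range (strictFloor β + 1)).filter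
    fun α => ((∑ i, α i : ℕ) : ℝ) < β

/-- Multi-indices `α` with `|α| = ⌊β⌋` (largest integer `< β`). -/
def multiIndicesEq (r : ℕ) (β : ℝ) : Finset (Fin r → ℕ) :=
  (Fintype.piFinset fun _ : Fin r => Finset.range (strictFloor β + 1)).filter
    fun α => ∑ i, α i = strictFloor β

/-- The Hölder norm appearing in the definition of the ball `C_r^β(D,K)`. -/
def holderNorm (r : ℕ) (β : ℝ) (D : Set (Fin r → ℝ)) (f : (Fin r → ℝ) → ℝ) : ℝ :=
  (∑ α ∈ multiIndicesLt r β, ⨆ x ∈ D, |multiPartial α f x|) +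
  ∑ α ∈ multiIndicesEq r β, ⨆ x ∈ D, ⨆ y ∈ D,
    |multiPartial α f x - multiPartial α f y| / ‖x - y‖ ^ (β - (strictFloor β : ℝ))

/-- The Hölder ball `C_r^β(D,K)`. -/
def HolderBall (r : ℕ) (β K : ℝ) (D : Set (Fin r → ℝ)) : Set ((Fin r → ℝ) → ℝ) :=
  {f | (∀ α : Fin r → ℕ, ∑ i, α i < strictFloor β →
          ∀ x ∈ D, DifferentiableAt ℝ (multiPartial α f) x) ∧
    holderNorm r β D f ≤ K}

/-- Univariate Hölder ball `C_1^α([A,B],K)` for `0 < α ≤ 1`. -/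
def holderBall1 (α K A B : ℝ) : Set (ℝ → ℝ) :=
  {h | (⨆ x ∈ Set.Icc A B, |h x|) +
      (⨆ x ∈ Set.Icc A B, ⨆ y ∈ Set.Icc A B, |h x - h y| / |x - y| ^ α) ≤ K}

/-! ## Composition classes -/

/-- The hypercube `[a,b]^r`. -/
def cube (r : ℕ) (a b : ℝ) : Set (Fin r → ℝ) := {x | ∀ i, x i ∈ Set.Icc a b}

/-- The composition `g_{k-1} ∘ ⋯ ∘ g_0`. -/
def compChain (d : ℕ → ℕ) (g : ∀ i, (Fin (d i) → ℝ) → Fin (d (i + 1)) → ℝ) :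
    (k : ℕ) → (Fin (d 0) → ℝ) → Fin (d k) → ℝ
  | 0 => fun x => x
  | k + 1 => fun x => g k (compChain d g k x)

/-- The composition class `G(q, d, t, β, K)` (with `d 0`-dimensional input on
`[0,1]^{d 0}` and real values, meaningful when `d (q+1) = 1`). -/
def CompositionClass (q : ℕ) (d t : ℕ → ℕ) (β : ℕ → ℝ) (K : ℝ) :
    Set ((Fin (d 0) → ℝ) → ℝ) :=
  {f | ∃ (a b : ℕ → ℝ) (g : ∀ i, (Fin (d i) → ℝ) → Fin (d (i + 1)) → ℝ),
    a 0 = 0 ∧ b 0 = 1 ∧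
    (∀ i ≤ q + 1, |a i| ≤ K ∧ |b i| ≤ K) ∧
    (∀ i ≤ q, ∀ x ∈ cube (d i) (a i) (b i), g i x ∈ cube (d (i + 1)) (a (i + 1)) (b (i + 1))) ∧
    (∀ i ≤ q, ∀ j : Fin (d (i + 1)), ∃ (idx : Fin (t i) → Fin (d i))
        (h : (Fin (t i) → ℝ) → ℝ),
        h ∈ HolderBall (t i) (β i) K (cube (t i) (a i) (b i)) ∧
        ∀ x ∈ cube (d i) (a i) (b i), g i x j = h fun k => x (idx k)) ∧
    ∀ x ∈ cube (d 0) 0 1, ∀ j, f x = compChain d g (q + 1) x j}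

/-! ## Rates -/

/-- Effective smoothness index `β_i^* = β_i ∏_{ℓ=i+1}^q (β_ℓ ∧ 1)`. -/
def betaStar (q : ℕ) (β : ℕ → ℝ) (i : ℕ) : ℝ :=
  β i * ∏ ℓ ∈ Finset.Icc (i + 1) q, min (β ℓ) 1

/-- The rate `φ_n = max_i n^{-2β_i^*/(2β_i^* + t_i)}`. -/
def phiRate (q : ℕ) (t : ℕ → ℕ) (β : ℕ → ℝ) (n : ℕ) : ℝ :=
  (Finset.range (q + 1)).sup' (Finset.nonempty_range_iff.mpr (Nat.succ_ne_zero q))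
    fun i => (n : ℝ) ^ (-(2 * betaStar q β i) / (2 * betaStar q β i + (t i : ℝ)))

/-! ## The nonparametric regression model -/

/-- Sample space carrying the design points `X_1,…,X_n`, the noise `ε_1,…,ε_n`
and an independent copy `X` of the design used to evaluate the prediction risk. -/
abbrev RegOmega (n d : ℕ) : Type :=
  (Fin n → (Fin d → ℝ)) × (Fin n → ℝ) × (Fin d → ℝ)

/-- Law of the data: `X_i` i.i.d. `μX`, `ε_i` i.i.d. `N(0,1)`, `X ∼ μX`, all independent. -/
def regP (n d : ℕ) (μX : Measure (Fin d → ℝ)) : Measure (RegOmega n d) :=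
  (Measure.pi fun _ : Fin n => μX).prod
    ((Measure.pi fun _ : Fin n => gaussianReal 0 1).prod μX)

/-- The observed sample `(X_i, Y_i)_{i=1,…,n}` with `Y_i = f0(X_i) + ε_i`. -/
def sampleOf {n d : ℕ} (f0 : (Fin d → ℝ) → ℝ) (ω : RegOmega n d) :
    Fin n → (Fin d → ℝ) × ℝ :=
  fun i => (ω.1 i, f0 (ω.1 i) + ω.2.1 i)

/-- The prediction error `R(f̂, f0) = E[(f̂(X) - f0(X))²]`. -/
def predRisk (n d : ℕ) (μX : Measure (Fin d → ℝ)) (f0 : (Fin d → ℝ) → ℝ)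
    (fhat : (Fin n → (Fin d → ℝ) × ℝ) → (Fin d → ℝ) → ℝ) : ℝ :=
  ∫ ω, (fhat (sampleOf f0 ω) ω.2.2 - f0 ω.2.2) ^ 2 ∂(regP n d μX)

/-- Empirical risk `n⁻¹ ∑_i (Y_i - f(X_i))²` of a fixed function `f`. -/
def empRisk {n d : ℕ} (ω : RegOmega n d) (f0 f : (Fin d → ℝ) → ℝ) : ℝ :=
  (1 / (n : ℝ)) * ∑ i : Fin n, (f0 (ω.1 i) + ω.2.1 i - f (ω.1 i)) ^ 2

/-- `Δ_n(f̂,f0)`: expected gap between the empirical risk of `f̂` and the minimal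
empirical risk over the class `C`. -/
def deltaN (n d : ℕ) (μX : Measure (Fin d → ℝ)) (f0 : (Fin d → ℝ) → ℝ)
    (fhat : (Fin n → (Fin d → ℝ) × ℝ) → (Fin d → ℝ) → ℝ)
    (C : Set ((Fin d → ℝ) → ℝ)) : ℝ :=
  ∫ ω, (empRisk ω f0 (fhat (sampleOf f0 ω)) - ⨅ f ∈ C, empRisk ω f0 f) ∂(regP n d μX)


/-! ## Approximate multiplication by iterated folding -/

/-- Iterated folding `w₀ = u`, `w_{s+1} = |w_s| - 2^{-(s+1)}`. -/
def foldSeq : ℕ → ℝ → ℝ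
  | 0, u => u
  | s + 1, u => |foldSeq s u| - (1 / 2) ^ (s + 1)

/-- The weighted sum `∑_{t<n} 2^{-t} |w_t|`, which equals `u² - w_n²` up to a constant. -/
def foldSum (n : ℕ) (u : ℝ) : ℝ := ∑ t ∈ Finset.range n, (1 / 2) ^ t * |foldSeq t u|

/-- Approximate product of two numbers, obtained by polarization. -/
def approxMul (n : ℕ) (x y : ℝ) : ℝ := foldSum n ((x + y) / 2) - foldSum n ((x - y) / 2)

lemma foldSum_succ (n : ℕ) (u : ℝ) :
    foldSum (n + 1) u = foldSum n u + (1 / 2) ^ n * |foldSeq n u| :=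
  Finset.sum_range_succ _ _

lemma foldSum_nonneg (n : ℕ) (u : ℝ) : 0 ≤ foldSum n u :=
  Finset.sum_nonneg fun _ _ => by positivity

lemma abs_foldSeq_le {u : ℝ} (hu : |u| ≤ 1) (s : ℕ) : |foldSeq s u| ≤ (1 / 2) ^ s := by
  induction s with
  | zero => simpa [foldSeq] using hu
  | succ s ih =>
    have h0 := abs_nonneg (foldSeq s u)
    have hp : ((1 : ℝ) / 2) ^ (s + 1) = (1 / 2) ^ s / 2 := by ring
    rw [foldSeq, abs_le]
    constructor <;> linarith

lemma foldSum_sub_sq (n : ℕ) (u v : ℝ) :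
    foldSum n u - u ^ 2 + foldSeq n u ^ 2 = foldSum n v - v ^ 2 + foldSeq n v ^ 2 := by
  induction n with
  | zero => simp [foldSum, foldSeq]
  | succ n ih =>
    simp only [foldSum_succ, foldSeq]
    have hu := sq_abs (foldSeq n u)
    have hv := sq_abs (foldSeq n v)
    have hp : ((1 : ℝ) / 2) ^ (n + 1) = (1 / 2) ^ n / 2 := by ring
    rw [hp]
    linear_combination ih + hu - hv

lemma abs_abs_foldSeq_sub_le (s : ℕ) (u v : ℝ) :
    |(|foldSeq s u| - |foldSeq s v|)| ≤ |(|u| - |v|)| := by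
  induction s with
  | zero => simp [foldSeq]
  | succ s ih =>
    refine (abs_abs_sub_abs_le _ _).trans (le_trans (le_of_eq ?_) ih)
    simp [foldSeq]

lemma foldSum_mono (n : ℕ) {u v : ℝ} (h : |u| ≤ |v|) : foldSum n u ≤ foldSum n v := by
  cases n with
  | zero => simp [foldSum]
  | succ n =>
    have key : (1 / 2) ^ n * (|v| - |u|) ≤ foldSum (n + 1) v - foldSum (n + 1) u := by
      induction n with
      | zero => simp [foldSum, foldSeq]
      | succ n ih =>
        have h1 := abs_abs_foldSeq_sub_le (n + 1) v u
        rw [abs_of_nonneg (sub_nonneg.2 h)] at h1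
        have h2 := mul_le_mul_of_nonneg_left (abs_le.1 h1).1
          (show (0 : ℝ) ≤ (1 / 2) ^ (n + 1) by positivity)
        have hp : ((1 : ℝ) / 2) ^ n = 2 * (1 / 2) ^ (n + 1) := by ring
        rw [hp] at ih
        rw [foldSum_succ (n + 1) v, foldSum_succ (n + 1) u]
        linarith
    have : 0 ≤ (1 / 2) ^ n * (|v| - |u|) := mul_nonneg (by positivity) (sub_nonneg.2 h)
    linarith

lemma abs_foldSeq_zero (s : ℕ) : |foldSeq (s + 1) 0| = (1 / 2) ^ (s + 1) := by
  induction s with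
  | zero => norm_num [foldSeq]
  | succ s ih =>
    have hp : ((1 : ℝ) / 2) ^ (s + 1) = 2 * (1 / 2) ^ (s + 1 + 1) := by ring
    rw [foldSeq, ih, hp, two_mul, add_sub_cancel_right, abs_of_nonneg (by positivity)]

lemma foldSum_le {v : ℝ} (hv : |v| ≤ 1) (n : ℕ) : foldSum n v ≤ foldSum n 0 + |v| := by
  cases n with
  | zero => simp [foldSum]
  | succ n =>
    induction n with
    | zero => simp [foldSum, foldSeq]
    | succ n ih =>
      have h := mul_le_mul_of_nonneg_left (abs_foldSeq_le hv (n + 1))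
        (show (0 : ℝ) ≤ (1 / 2) ^ (n + 1) by positivity)
      rw [foldSum_succ (n + 1) v, foldSum_succ (n + 1) 0, abs_foldSeq_zero]
      linarith

lemma approxMul_nonneg (n : ℕ) {x y : ℝ} (hx : 0 ≤ x) (hy : 0 ≤ y) : 0 ≤ approxMul n x y := by
  refine sub_nonneg.2 (foldSum_mono n ?_)
  rw [abs_of_nonneg (show 0 ≤ (x + y) / 2 by positivity), abs_le]
  constructor <;> linarith

lemma approxMul_le_one (n : ℕ) {x y : ℝ} (hx : x ∈ Set.Icc (0 : ℝ) 1)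
    (hy : y ∈ Set.Icc (0 : ℝ) 1) : approxMul n x y ≤ 1 := by
  obtain ⟨hx0, hx1⟩ := hx
  obtain ⟨hy0, hy1⟩ := hy
  have h : |(x + y) / 2| ≤ 1 := by
    rw [abs_le]
    constructor <;> linarith
  have h1 := foldSum_le h n
  have h2 : foldSum n 0 ≤ foldSum n ((x - y) / 2) := foldSum_mono n (by simp)
  unfold approxMul
  linarith

lemma approxMul_zero_left (n : ℕ) (y : ℝ) : approxMul n 0 y = 0 := by
  have h : |(0 + y) / 2| = |(0 - y) / 2| := by
    rw [← abs_neg]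
    congr 1
    ring
  exact sub_eq_zero.2 (le_antisymm (foldSum_mono n h.le) (foldSum_mono n h.ge))

lemma approxMul_zero_right (n : ℕ) (x : ℝ) : approxMul n x 0 = 0 := by
  simp [approxMul]

lemma abs_approxMul_sub_le (n : ℕ) {x y : ℝ} (hx : x ∈ Set.Icc (0 : ℝ) 1)
    (hy : y ∈ Set.Icc (0 : ℝ) 1) : |approxMul n x y - x * y| ≤ (1 / 4) ^ n := by
  obtain ⟨hx0, hx1⟩ := hx
  obtain ⟨hy0, hy1⟩ := hy
  have hsq : ∀ u : ℝ, |u| ≤ 1 → foldSeq n u ^ 2 ≤ (1 / 4) ^ n := fun u hu => by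
    have h := pow_le_pow_left₀ (abs_nonneg _) (abs_foldSeq_le hu n) 2
    rw [sq_abs, ← pow_mul, mul_comm, pow_mul] at h
    norm_num at h ⊢
    exact h
  have h1 := hsq ((x + y) / 2) (by rw [abs_le]; constructor <;> linarith)
  have h2 := hsq ((x - y) / 2) (by rw [abs_le]; constructor <;> linarith)
  have h3 := foldSum_sub_sq n ((x + y) / 2) ((x - y) / 2)
  have h4 : approxMul n x y - x * y
      = foldSeq n ((x - y) / 2) ^ 2 - foldSeq n ((x + y) / 2) ^ 2 := by
    unfold approxMul
    linear_combination h3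
  have h5 := sq_nonneg (foldSeq n ((x + y) / 2))
  have h6 := sq_nonneg (foldSeq n ((x - y) / 2))
  rw [h4, abs_le]
  constructor <;> linarith

/-! ## Binary trees of approximate products -/

/-- Value of node `j` at height `l` in the binary tree of approximate products with leaves `y`. -/
def mulTree (n : ℕ) (y : ℕ → ℝ) : ℕ → ℕ → ℝ
  | 0, j => y j
  | l + 1, j => approxMul n (mulTree n y l (2 * j)) (mulTree n y l (2 * j + 1))

lemma mulTree_mem_Icc (n : ℕ) {y : ℕ → ℝ} (hy : ∀ i, y i ∈ Set.Icc (0 : ℝ) 1) (l j : ℕ) :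
    mulTree n y l j ∈ Set.Icc (0 : ℝ) 1 := by
  induction l generalizing j with
  | zero => exact hy j
  | succ l ih =>
    exact ⟨approxMul_nonneg n (ih _).1 (ih _).1, approxMul_le_one n (ih _) (ih _)⟩

/-- The exact product of the leaves below node `j` at height `l`. -/
def leafProd (y : ℕ → ℝ) (l j : ℕ) : ℝ := ∏ i ∈ Finset.range (2 ^ l), y (2 ^ l * j + i)

lemma leafProd_succ (y : ℕ → ℝ) (l j : ℕ) :
    leafProd y (l + 1) j = leafProd y l (2 * j) * leafProd y l (2 * j + 1) := by
  unfold leafProd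
  rw [pow_succ, mul_two, Finset.prod_range_add]
  congr 1 <;> refine Finset.prod_congr rfl fun i _ => congrArg y ?_ <;> ring

lemma leafProd_mem_Icc {y : ℕ → ℝ} (hy : ∀ i, y i ∈ Set.Icc (0 : ℝ) 1) (l j : ℕ) :
    leafProd y l j ∈ Set.Icc (0 : ℝ) 1 :=
  ⟨Finset.prod_nonneg fun _ _ => (hy _).1,
    Finset.prod_le_one (fun _ _ => (hy _).1) fun _ _ => (hy _).2⟩

lemma mulTree_eq_zero (n : ℕ) {y : ℕ → ℝ} {l j : ℕ} (h : leafProd y l j = 0) :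
    mulTree n y l j = 0 := by
  induction l generalizing j with
  | zero => simpa [leafProd, mulTree] using h
  | succ l ih =>
    rw [leafProd_succ, mul_eq_zero] at h
    rcases h with h | h <;> simp [mulTree, ih h, approxMul_zero_left, approxMul_zero_right]

lemma abs_mulTree_sub_le (n : ℕ) {y : ℕ → ℝ} (hy : ∀ i, y i ∈ Set.Icc (0 : ℝ) 1) (l j : ℕ) :
    |mulTree n y l j - leafProd y l j| ≤ (2 ^ l - 1) * (1 / 4) ^ n := by
  induction l generalizing j with
  | zero => simp [leafProd, mulTree]
  | succ l ih =>
    rw [leafProd_succ, mulTree]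
    have ha := mulTree_mem_Icc n hy l (2 * j)
    have hb := mulTree_mem_Icc n hy l (2 * j + 1)
    have hc := leafProd_mem_Icc hy l (2 * j)
    have hA := ih (2 * j)
    have hB := ih (2 * j + 1)
    have hM := abs_approxMul_sub_le n ha hb
    generalize mulTree n y l (2 * j) = a at *
    generalize mulTree n y l (2 * j + 1) = b at *
    generalize leafProd y l (2 * j) = c at *
    generalize leafProd y l (2 * j + 1) = d at *
    have h1 : |(a - c) * b| ≤ |a - c| := by
      rw [abs_mul, abs_of_nonneg hb.1]
      exact mul_le_of_le_one_right (abs_nonneg _) hb.2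
    have h2 : |c * (b - d)| ≤ |b - d| := by
      rw [abs_mul, abs_of_nonneg hc.1]
      exact mul_le_of_le_one_left (abs_nonneg _) hc.2
    have h3 : approxMul n a b - c * d = (approxMul n a b - a * b) + (a - c) * b + c * (b - d) := by
      ring
    rw [h3]
    refine (abs_add_three _ _ _).trans ?_
    rw [pow_succ]
    linarith

/-! ## Assembling networks from their unit values -/

/-- A function is computed by a network as soon as the activations `U k` of its successive hidden
layers are obtained from one another by bounded affine maps followed by the ReLU. -/
lemma mem_scalarNetClassD_of_units {r L M : ℕ} {p : ℕ → ℕ} (hp0 : p 0 = r)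
    (hpmid : ∀ i, 1 ≤ i → i ≤ L + 1 → p i = M) (U : ℕ → (Fin r → ℝ) → ℕ → ℝ)
    (f : (Fin r → ℝ) → ℝ)
    (hin : ∀ a, ∃ (w : Fin r → ℝ) (v : ℝ), (∀ i, |w i| ≤ 1) ∧ |v| ≤ 1 ∧
      ∀ x, U 0 x a = relu (∑ i, w i * x i - v))
    (hstep : ∀ k a, ∃ (w : ℕ → ℝ) (v : ℝ), (∀ b, |w b| ≤ 1) ∧ |v| ≤ 1 ∧
      ∀ x, U (k + 1) x a = relu (∑ b ∈ Finset.range M, w b * U k x b - v))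
    (hout : ∃ w : ℕ → ℝ, (∀ b, |w b| ≤ 1) ∧
      ∀ x, f x = ∑ b ∈ Finset.range M, w b * U L x b) :
    f ∈ ScalarNetClassD r (L + 1) p := by
  subst hp0
  choose w₀ v₀ hw₀ hv₀ hU₀ using hin
  choose w v hw hv hU using hstep
  obtain ⟨wo, hwo, hf⟩ := hout
  let W : ∀ i, Matrix (Fin (p (i + 1))) (Fin (p i)) ℝ
    | 0 => fun a b => w₀ a b
    | k + 1 => fun a b => if k = L then wo b else w k a b
  let V : ∀ i, Fin (p i) → ℝ
    | 0 => fun _ => 0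
    | 1 => fun a => v₀ a
    | k + 2 => fun a => v k a
  refine ⟨rfl, networkFun (L + 1) p W V, ⟨W, V, ?_, ?_, rfl⟩, ?_⟩
  · rintro (_ | k) a b
    · exact hw₀ _ _
    · by_cases h : k = L
      · simpa [W, h] using hwo b
      · simpa [W, h] using hw k a b
  · rintro (_ | _ | k) a
    · simp [V]
    · exact hv₀ _
    · exact hv _ _
  · intro x j
    have key : ∀ k ≤ L, ∀ a : Fin (p (k + 1)),
        shiftAct (V (k + 1)) (netLayers p W V x k) a = U k x a := by
      intro k
      induction k with
      | zero =>
        intro _ a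
        rw [hU₀]
        rfl
      | succ k ih =>
        intro hk a
        have hkL : k ≠ L := by omega
        have hsum : netLayers p W V x (k + 1) a
            = ∑ b ∈ Finset.range M, w k a b * U k x b := by
          rw [← hpmid (k + 1) (by omega) (by omega), ← Fin.sum_univ_eq_sum_range
            (fun b => w k a b * U k x b)]
          change ∑ b, W (k + 1) a b * shiftAct (V (k + 1)) (netLayers p W V x k) b = _
          refine Finset.sum_congr rfl fun b _ => ?_
          rw [ih (by omega) b]
          simp [W, hkL]
        rw [hU, ← hsum]
        rfl
    rw [hf, ← hpmid (L + 1) (by omega) le_rfl, ← Fin.sum_univ_eq_sum_range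
      (fun b => wo b * U L x b)]
    change _ = ∑ b, W (L + 1) j b * shiftAct (V (L + 1)) (netLayers p W V x L) b
    refine Finset.sum_congr rfl fun b _ => ?_
    rw [← key L le_rfl b]
    simp [W]

/-! ## The product network -/

lemma sum_range_six_mul (r : ℕ) (g : ℕ → ℝ) :
    ∑ b ∈ Finset.range (6 * r), g b
      = ∑ j ∈ Finset.range r, ∑ c ∈ Finset.range 6, g (6 * j + c) := by
  induction r with
  | zero => simp
  | succ r ih => rw [mul_add, mul_one, Finset.sum_range_add, ih, Finset.sum_range_succ _ r]

/-- The coefficient vector `μ` placed on the `j`-th block of six units. -/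
def blockCoeff (j : ℕ) (μ : ℕ → ℝ) (b : ℕ) : ℝ := if b / 6 = j then μ (b % 6) else 0

lemma sum_blockCoeff {r j : ℕ} (hj : j < r) (μ u : ℕ → ℝ) :
    ∑ b ∈ Finset.range (6 * r), blockCoeff j μ b * u b
      = ∑ c ∈ Finset.range 6, μ c * u (6 * j + c) := by
  rw [sum_range_six_mul, Finset.sum_eq_single_of_mem j (Finset.mem_range.2 hj)]
  · refine Finset.sum_congr rfl fun c hc => ?_
    have hc := Finset.mem_range.1 hc
    rw [blockCoeff, if_pos (by omega), show (6 * j + c) % 6 = c by omega]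
  · refine fun i _ hi => Finset.sum_eq_zero fun c hc => ?_
    have hc := Finset.mem_range.1 hc
    rw [blockCoeff, if_neg (by omega), zero_mul]

lemma abs_blockCoeff_le (j : ℕ) {μ : ℕ → ℝ} (hμ : ∀ c, |μ c| ≤ 1) (b : ℕ) :
    |blockCoeff j μ b| ≤ 1 := by
  unfold blockCoeff
  split_ifs
  · exact hμ _
  · simp

/-- The six units which, after `s` folding steps, encode the approximate product of `x` and `y`. -/
def mulUnit (s : ℕ) (x y : ℝ) : ℕ → ℝ
  | 0 => relu (foldSeq s ((x + y) / 2))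
  | 1 => relu (-foldSeq s ((x + y) / 2))
  | 2 => foldSum s ((x + y) / 2)
  | 3 => relu (foldSeq s ((x - y) / 2))
  | 4 => relu (-foldSeq s ((x - y) / 2))
  | 5 => foldSum s ((x - y) / 2)
  | _ => 0

/-- Coefficients of `(x + y) / 2` and `(x - y) / 2` in the entry units: weight of `x`. -/
def entryLeft : ℕ → ℝ
  | 0 => 1 / 2
  | 1 => -(1 / 2)
  | 3 => 1 / 2
  | 4 => -(1 / 2)
  | _ => 0

/-- Coefficients of `(x + y) / 2` and `(x - y) / 2` in the entry units: weight of `y`. -/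
def entryRight : ℕ → ℝ
  | 0 => 1 / 2
  | 1 => -(1 / 2)
  | 3 => -(1 / 2)
  | 4 => 1 / 2
  | _ => 0

/-- Weights recovering `approxMul (s + 1) x y` from `mulUnit s x y`. -/
def readout (s : ℕ) : ℕ → ℝ
  | 0 => (1 / 2) ^ s
  | 1 => (1 / 2) ^ s
  | 2 => 1
  | 3 => -(1 / 2) ^ s
  | 4 => -(1 / 2) ^ s
  | 5 => -1
  | _ => 0

/-- Weights of one folding step. -/
def foldWeight (s : ℕ) : ℕ → ℕ → ℝ
  | 0, 0 => 1
  | 0, 1 => 1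
  | 1, 0 => -1
  | 1, 1 => -1
  | 2, 0 => (1 / 2) ^ s
  | 2, 1 => (1 / 2) ^ s
  | 2, 2 => 1
  | 3, 3 => 1
  | 3, 4 => 1
  | 4, 3 => -1
  | 4, 4 => -1
  | 5, 3 => (1 / 2) ^ s
  | 5, 4 => (1 / 2) ^ s
  | 5, 5 => 1
  | _, _ => 0

/-- Shifts of one folding step. -/
def foldShift (s : ℕ) : ℕ → ℝ
  | 0 => (1 / 2) ^ (s + 1)
  | 1 => -(1 / 2) ^ (s + 1)
  | 3 => (1 / 2) ^ (s + 1)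
  | 4 => -(1 / 2) ^ (s + 1)
  | _ => 0

lemma abs_entryLeft_le (c : ℕ) : |entryLeft c| ≤ 1 / 2 := by
  unfold entryLeft
  split <;> norm_num [abs_le]

lemma abs_entryRight_le (c : ℕ) : |entryRight c| ≤ 1 / 2 := by
  unfold entryRight
  split <;> norm_num [abs_le]

lemma half_pow_le_one (s : ℕ) : ((1 : ℝ) / 2) ^ s ≤ 1 :=
  pow_le_one₀ (by norm_num) (by norm_num)

lemma abs_half_pow_le_one (s : ℕ) : |((1 : ℝ) / 2) ^ s| ≤ 1 := by
  rw [abs_of_nonneg (by positivity)]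
  exact half_pow_le_one s

lemma abs_readout_le (s c : ℕ) : |readout s c| ≤ 1 := by
  unfold readout
  split <;> first | exact abs_half_pow_le_one s | (rw [abs_neg]; exact abs_half_pow_le_one s) | simp

lemma abs_foldWeight_le (s a b : ℕ) : |foldWeight s a b| ≤ 1 := by
  unfold foldWeight
  split <;> first | exact abs_half_pow_le_one s | simp

lemma abs_foldShift_le (s a : ℕ) : |foldShift s a| ≤ 1 := by
  unfold foldShift
  split <;>
    first | exact abs_half_pow_le_one _ | (rw [abs_neg]; exact abs_half_pow_le_one _) | simp

lemma relu_add_relu_neg (u : ℝ) : relu u + relu (-u) = |u| := by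
  unfold relu
  rcases le_total 0 u with h | h
  · rw [max_eq_left h, max_eq_right (by linarith), abs_of_nonneg h, add_zero]
  · rw [max_eq_right h, max_eq_left (by linarith), abs_of_nonpos h, zero_add]

lemma relu_of_nonneg {u : ℝ} (h : 0 ≤ u) : relu u = u := max_eq_left h

lemma relu_zero : relu 0 = 0 := relu_of_nonneg le_rfl

lemma mulUnit_zero (x y : ℝ) (c : ℕ) :
    mulUnit 0 x y c = relu (entryLeft c * x + entryRight c * y) := by
  unfold mulUnit entryLeft entryRight
  split <;> simp [foldSeq, foldSum, relu_zero] <;> congr 1 <;> ring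

lemma sum_readout (s : ℕ) (x y : ℝ) :
    ∑ c ∈ Finset.range 6, readout s c * mulUnit s x y c = approxMul (s + 1) x y := by
  simp only [Finset.sum_range_succ, Finset.sum_range_zero, readout, mulUnit, approxMul,
    foldSum_succ, ← relu_add_relu_neg]
  ring

lemma mulUnit_succ (s : ℕ) (x y : ℝ) {a : ℕ} (ha : a < 6) :
    mulUnit (s + 1) x y a
      = relu (∑ c ∈ Finset.range 6, foldWeight s a c * mulUnit s x y c - foldShift s a) := by
  interval_cases a <;>
    simp only [Finset.sum_range_succ, Finset.sum_range_zero, foldWeight, mulUnit, foldShift,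
      foldSeq] <;>
    try rw [← relu_of_nonneg (foldSum_nonneg (s + 1) _)]
  all_goals
    simp only [foldSum_succ, ← relu_add_relu_neg]
    congr 1
    ring

/-- The input, extended by ones. -/
def padOne {r : ℕ} (x : Fin r → ℝ) (i : ℕ) : ℝ := if h : i < r then x ⟨i, h⟩ else 1

/-- Activation of unit `a` in hidden layer `k + 1` of the product network: every level of the tree
takes `n` layers and every pair of nodes takes six units. -/
def treeUnit {r : ℕ} (n q k : ℕ) (x : Fin r → ℝ) (a : ℕ) : ℝ :=
  if (a / 6 + 1) * 2 ^ (k / n + 1) ≤ 2 ^ q then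
    mulUnit (k % n) (mulTree n (padOne x) (k / n) (2 * (a / 6)))
      (mulTree n (padOne x) (k / n) (2 * (a / 6) + 1)) (a % 6)
  else 0

lemma exists_affine_padOne (r j : ℕ) {α : ℝ} (hα : |α| ≤ 1 / 2) :
    ∃ (w : Fin r → ℝ) (v : ℝ), (∀ i, |w i| ≤ if (i : ℕ) = j then 1 / 2 else 0) ∧ |v| ≤ 1 / 2 ∧
      ∀ x : Fin r → ℝ, α * padOne x j = ∑ i, w i * x i - v := by
  by_cases h : j < r
  · refine ⟨fun i => if (i : ℕ) = j then α else 0, 0, fun i => ?_, by norm_num, fun x => ?_⟩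
    · dsimp only
      split_ifs
      · exact hα
      · simp
    · rw [Finset.sum_eq_single (⟨j, h⟩ : Fin r)]
      · simp [padOne, h]
      · intro i _ hi
        simp [show (i : ℕ) ≠ j from fun h' => hi (Fin.ext h')]
      · simp
  · refine ⟨0, -α, fun i => ?_, by rwa [abs_neg], fun x => by simp [padOne, h]⟩
    split_ifs <;> simp

lemma exists_treeUnit_zero (r n q a : ℕ) :
    ∃ (w : Fin r → ℝ) (v : ℝ), (∀ i, |w i| ≤ 1) ∧ |v| ≤ 1 ∧
      ∀ x : Fin r → ℝ, treeUnit n q 0 x a = relu (∑ i, w i * x i - v) := by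
  by_cases h : (a / 6 + 1) * 2 ^ (0 / n + 1) ≤ 2 ^ q
  · obtain ⟨w, v, hw, hv, hx⟩ := exists_affine_padOne r (2 * (a / 6)) (abs_entryLeft_le (a % 6))
    obtain ⟨w', v', hw', hv', hx'⟩ :=
      exists_affine_padOne r (2 * (a / 6) + 1) (abs_entryRight_le (a % 6))
    refine ⟨w + w', v + v', fun i => ?_, ?_, fun x => ?_⟩
    · have h1 := hw i
      have h2 := hw' i
      refine (abs_add_le _ _).trans ?_
      split_ifs at h1 h2 <;> linarith
    · exact (abs_add_le _ _).trans (by linarith)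
    · rw [treeUnit, if_pos h, Nat.zero_mod, mulUnit_zero, Nat.zero_div]
      simp only [mulTree, hx, hx', Pi.add_apply, add_mul, Finset.sum_add_distrib]
      congr 1
      ring
  · refine ⟨0, 0, by simp, by simp, fun x => ?_⟩
    rw [treeUnit, if_neg h]
    simp [relu_zero]

lemma treeUnit_block {r n q k j c : ℕ} (x : Fin r → ℝ) (hc : c < 6)
    (hj : (j + 1) * 2 ^ (k / n + 1) ≤ 2 ^ q) :
    treeUnit n q k x (6 * j + c) = mulUnit (k % n) (mulTree n (padOne x) (k / n) (2 * j))
      (mulTree n (padOne x) (k / n) (2 * j + 1)) c := by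
  rw [treeUnit, show (6 * j + c) / 6 = j by omega, show (6 * j + c) % 6 = c by omega, if_pos hj]

lemma lt_of_mul_two_pow_le {r q l j : ℕ} (hq : 2 ^ q < 2 * r)
    (hj : (j + 1) * 2 ^ (l + 1) ≤ 2 ^ q) : j < r := by
  have h1 : 1 ≤ 2 ^ l := Nat.one_le_two_pow
  have h2 := Nat.mul_le_mul_left (j + 1) h1
  rw [pow_succ, ← mul_assoc] at hj
  omega

/-- At the last layer of a level, the readout weights recover the nodes of the next level. -/
lemma sum_readout_treeUnit {r n q k j : ℕ} (hq : 2 ^ q < 2 * r) (hn : k % n + 1 = n)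
    (hj : (j + 1) * 2 ^ (k / n + 1) ≤ 2 ^ q) (x : Fin r → ℝ) :
    ∑ b ∈ Finset.range (6 * r), blockCoeff j (readout (k % n)) b * treeUnit n q k x b
      = mulTree n (padOne x) (k / n + 1) j := by
  rw [sum_blockCoeff (lt_of_mul_two_pow_le hq hj)]
  have h : mulTree n (padOne x) (k / n + 1) j = approxMul (k % n + 1)
      (mulTree n (padOne x) (k / n) (2 * j)) (mulTree n (padOne x) (k / n) (2 * j + 1)) := by
    rw [hn, mulTree]
  rw [h, ← sum_readout]
  refine Finset.sum_congr rfl fun c hc => ?_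
  rw [treeUnit_block x (Finset.mem_range.1 hc) hj]

lemma exists_treeUnit_succ {r n q : ℕ} (hn : 0 < n) (hq : 2 ^ q < 2 * r) (k a : ℕ) :
    ∃ (w : ℕ → ℝ) (v : ℝ), (∀ b, |w b| ≤ 1) ∧ |v| ≤ 1 ∧ ∀ x : Fin r → ℝ,
      treeUnit n q (k + 1) x a
        = relu (∑ b ∈ Finset.range (6 * r), w b * treeUnit n q k x b - v) := by
  by_cases h : (a / 6 + 1) * 2 ^ ((k + 1) / n + 1) ≤ 2 ^ q
  swap
  · refine ⟨0, 0, by simp, by simp, fun x => ?_⟩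
    rw [treeUnit, if_neg h]
    simp [relu_zero]
  have ha : a % 6 < 6 := Nat.mod_lt _ (by norm_num)
  have hlt := Nat.mod_lt k hn
  have hdm := Nat.div_add_mod k n
  by_cases hk : k % n + 1 = n
  · obtain ⟨hdiv, hmod⟩ : (k + 1) / n = k / n + 1 ∧ (k + 1) % n = 0 :=
      (Nat.div_mod_unique hn).2 ⟨by rw [mul_add]; omega, hn⟩
    rw [hdiv] at h
    have hj : (2 * (a / 6) + 1 + 1) * 2 ^ (k / n + 1) ≤ 2 ^ q := by
      refine le_trans (le_of_eq ?_) h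
      ring
    have hj' : (2 * (a / 6) + 1) * 2 ^ (k / n + 1) ≤ 2 ^ q :=
      (Nat.mul_le_mul_right _ (Nat.le_succ _)).trans hj
    refine ⟨fun b => entryLeft (a % 6) * blockCoeff (2 * (a / 6)) (readout (k % n)) b
      + entryRight (a % 6) * blockCoeff (2 * (a / 6) + 1) (readout (k % n)) b, 0,
      fun b => ?_, by simp, fun x => ?_⟩
    · refine (abs_add_le _ _).trans ?_
      rw [abs_mul, abs_mul]
      have h1 := mul_le_mul (abs_entryLeft_le (a % 6))
        (abs_blockCoeff_le (2 * (a / 6)) (abs_readout_le (k % n)) b) (abs_nonneg _) (by norm_num)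
      have h2 := mul_le_mul (abs_entryRight_le (a % 6))
        (abs_blockCoeff_le (2 * (a / 6) + 1) (abs_readout_le (k % n)) b) (abs_nonneg _)
        (by norm_num)
      linarith
    · simp only [add_mul, mul_assoc, Finset.sum_add_distrib, ← Finset.mul_sum]
      rw [sum_readout_treeUnit hq hk hj, sum_readout_treeUnit hq hk hj', treeUnit, hdiv, if_pos h,
        hmod, mulUnit_zero, sub_zero]
  · obtain ⟨hdiv, hmod⟩ : (k + 1) / n = k / n ∧ (k + 1) % n = k % n + 1 :=
      (Nat.div_mod_unique hn).2 ⟨by omega, by omega⟩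
    rw [hdiv] at h
    refine ⟨blockCoeff (a / 6) (foldWeight (k % n) (a % 6)), foldShift (k % n) (a % 6),
      abs_blockCoeff_le _ (abs_foldWeight_le _ _), abs_foldShift_le _ _, fun x => ?_⟩
    rw [sum_blockCoeff (lt_of_mul_two_pow_le hq h), treeUnit, hdiv, if_pos h, hmod,
      mulUnit_succ _ _ _ ha]
    congr 2
    refine Finset.sum_congr rfl fun c hc => ?_
    rw [treeUnit_block x (Finset.mem_range.1 hc) h]

lemma mulTree_mem_scalarNetClassD {r n q : ℕ} (hn : 0 < n) (hq0 : 0 < q) (hq : 2 ^ q < 2 * r)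
    {p : ℕ → ℕ} (hp0 : p 0 = r) (hpmid : ∀ i, 1 ≤ i → i ≤ n * q → p i = 6 * r) :
    (fun x : Fin r → ℝ => mulTree n (padOne x) q 0) ∈ ScalarNetClassD r (n * q) p := by
  obtain ⟨n, rfl⟩ := Nat.exists_eq_add_of_le' hn
  obtain ⟨q, rfl⟩ := Nat.exists_eq_add_of_le' hq0
  obtain ⟨hdiv, hmod⟩ : ((n + 1) * q + n) / (n + 1) = q ∧ ((n + 1) * q + n) % (n + 1) = n :=
    (Nat.div_mod_unique hn).2 ⟨by ring, Nat.lt_succ_self n⟩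
  have hL : (n + 1) * (q + 1) = (n + 1) * q + n + 1 := by ring
  rw [hL] at hpmid ⊢
  refine mem_scalarNetClassD_of_units hp0 hpmid (treeUnit (n + 1) (q + 1)) _
    (exists_treeUnit_zero r _ _) (exists_treeUnit_succ hn hq)
    ⟨blockCoeff 0 (readout (((n + 1) * q + n) % (n + 1))),
      abs_blockCoeff_le _ (abs_readout_le _), fun x => ?_⟩
  rw [sum_readout_treeUnit hq (by rw [hmod]) (by rw [hdiv]; simp), hdiv]

lemma id_mem_scalarNetClassD {p : ℕ → ℕ} (hp0 : p 0 = 1) :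
    (fun x : Fin 1 → ℝ => x 0) ∈ ScalarNetClassD 1 0 p := by
  refine ⟨hp0, networkFun 0 p (fun _ _ _ => 1) fun _ _ => 0,
    ⟨_, _, by simp, by simp, rfl⟩, fun x j => ?_⟩
  simp only [networkFun, netLayers, Matrix.mulVec, dotProduct, one_mul]
  rw [Fin.sum_congr' x hp0, Fin.sum_univ_one]

lemma padOne_mem_Icc {r : ℕ} {x : Fin r → ℝ} (hx : x ∈ unitCube r) (i : ℕ) :
    padOne x i ∈ Set.Icc (0 : ℝ) 1 := by
  unfold padOne
  split_ifs
  · exact hx _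
  · simp

lemma leafProd_padOne {r q : ℕ} (hr : r ≤ 2 ^ q) (x : Fin r → ℝ) :
    leafProd (padOne x) q 0 = ∏ i, x i := by
  obtain ⟨t, ht⟩ := Nat.exists_eq_add_of_le hr
  rw [leafProd, ht, Finset.prod_range_add, ← Fin.prod_univ_eq_prod_range
    (fun i => padOne x ((r + t) * 0 + i))]
  simp [padOne]

/-- Lemma A.3: ReLU network approximating the product of `r`
numbers. -/
theorem statement14 (m r : ℕ) (hm : 1 ≤ m) (hr : 1 ≤ r) (L : ℕ)
    (hL : L = (m + 5) * Nat.clog 2 r) (p : ℕ → ℕ)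
    (hp0 : p 0 = r) (hpL : p (L + 1) = 1)
    (hpmid : ∀ i, 1 ≤ i → i ≤ L → p i = 6 * r) :
    ∃ Mult : (Fin r → ℝ) → ℝ,
      Mult ∈ ScalarNetClassD r L p ∧
      ∀ x ∈ unitCube r,
        Mult x ∈ Set.Icc (0 : ℝ) 1 ∧
        |Mult x - ∏ i, x i| ≤ (r : ℝ) ^ 2 * ((2 : ℝ) ^ m)⁻¹ ∧
        ((∃ i, x i = 0) → Mult x = 0) := by
  rcases hr.eq_or_lt with rfl | hr1
  · obtain rfl : L = 0 := by simpa using hL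
    refine ⟨fun x => x 0, id_mem_scalarNetClassD hp0, fun x hx => ⟨hx 0, ?_, ?_⟩⟩
    · simp
    · rintro ⟨i, hi⟩
      rwa [Subsingleton.elim 0 i]
  · have hq0 : 0 < Nat.clog 2 r := Nat.clog_pos one_lt_two hr1
    have hle : r ≤ 2 ^ Nat.clog 2 r := Nat.le_pow_clog one_lt_two r
    have hlt : 2 ^ Nat.clog 2 r < 2 * r := by
      have h := Nat.pow_pred_clog_lt_self one_lt_two hr1
      obtain ⟨t, ht⟩ := Nat.exists_eq_add_of_le' hq0
      rw [ht, Nat.pred_succ] at h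
      rw [ht, pow_succ]
      omega
    subst hL
    refine ⟨_, mulTree_mem_scalarNetClassD (by omega) hq0 hlt hp0 hpmid, fun x hx => ?_⟩
    have hy := padOne_mem_Icc hx
    refine ⟨mulTree_mem_Icc _ hy _ _, ?_, ?_⟩
    · rw [← leafProd_padOne hle x]
      refine (abs_mulTree_sub_le _ hy _ _).trans ?_
      have h1 : (2 : ℝ) ^ Nat.clog 2 r ≤ 2 * r := by exact_mod_cast hlt.le
      have h2 : (2 : ℝ) ≤ r := by exact_mod_cast hr1
      have h3 : ((1 : ℝ) / 4) ^ (m + 5) ≤ (2 ^ m)⁻¹ := by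
        rw [← inv_pow, ← one_div]
        calc ((1 : ℝ) / 4) ^ (m + 5) ≤ (1 / 4) ^ m :=
              pow_le_pow_of_le_one (by norm_num) (by norm_num) (by omega)
          _ ≤ (1 / 2) ^ m := pow_le_pow_left₀ (by norm_num) (by norm_num) _
      exact mul_le_mul (by nlinarith) h3 (by positivity) (by positivity)
    · rintro ⟨i, hi⟩
      apply mulTree_eq_zero
      rw [leafProd_padOne hle]
      exact Finset.prod_eq_zero (Finset.mem_univ i) hi

end
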